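/- Let Λ be an artin algebra, M an indecomposable finite length Λ-module, and Y a module with a homogeneous M-filtration. If U is a piling submodule of Y with |U| ≤ |M|, then U is isomorphic to a submodule of M. -/

import Mathlib

/-!
Setting: `k` is a commutative artinian ring and `Λ` an artin `k`-algebra
(an algebra over `k` which is finitely generated as a `k`-module).
All modules considered are `Λ`-modules of finite length (`IsFiniteLength Λ M`),
and `|M|` denotes the length of `M`, implemented as the height
`Order.height (⊤ : Submodule Λ M)` of the lattice of submodules
(for a submodule `N` of an ambient module, its length is `Order.height N`).
-/

universe u v

open Submodule

section GRDefs

variable (Λ : Type u) [Ring Λ]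

/-- A submodule `N` of an ambient module is indecomposable (as a module):
it is nonzero, and whenever it is the direct sum of two submodules, one of them is zero. -/
def IndecSub {Y : Type v} [AddCommGroup Y] [Module Λ Y] (N : Submodule Λ Y) : Prop :=
  N ≠ ⊥ ∧ ∀ A B : Submodule Λ Y, A ≤ N → B ≤ N → A ⊔ B = N → A ⊓ B = ⊥ → A = ⊥ ∨ B = ⊥

/-- A module is indecomposable iff its top submodule is. -/
def IndecMod (M : Type v) [AddCommGroup M] [Module Λ M] : Prop :=
  IndecSub Λ (⊤ : Submodule Λ M)

/-- The length `|M|` of a module, as an extended natural number. -/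
noncomputable def modLen (M : Type v) [AddCommGroup M] [Module Λ M] : ℕ∞ :=
  Order.height (⊤ : Submodule Λ M)

/-- The length `|N|` of a submodule of an ambient module, as a natural number. -/
noncomputable def subLen {Y : Type v} [AddCommGroup Y] [Module Λ Y] (N : Submodule Λ Y) : ℕ :=
  (Order.height N).toNat

open Classical in
/-- Fuel-based auxiliary function for the Gabriel-Roiter measure. -/
noncomputable def muAux {Y : Type v} [AddCommGroup Y] [Module Λ Y] :
    ℕ → Submodule Λ Y → ℝ
  | 0, _ => 0
  | n + 1, N =>
      (if IndecSub Λ N then (2 : ℝ) ^ (-(subLen Λ N : ℤ)) else 0)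
        + sSup (muAux n '' {N' : Submodule Λ Y | N' < N})

/-- The Gabriel-Roiter measure `μ(N)` of a submodule `N` of an ambient module:
`μ(0) = 0`; if `N ≠ 0` is decomposable, `μ(N)` is the maximum of `μ(N')` over proper
submodules `N'` of `N`; if `N` is indecomposable, `μ(N) = 2^(-|N|)` plus this maximum.
(For modules of finite length the supremum is a maximum and the fuel `|N|` suffices for
the recursion, so this agrees with the usual inductive definition; the measure of a
submodule depends only on the sublattice of its submodules, hence it does not matter
in which ambient module it is computed.) -/
noncomputable def mu {Y : Type v} [AddCommGroup Y] [Module Λ Y] (N : Submodule Λ Y) : ℝ :=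
  muAux Λ (subLen Λ N) N

/-- The Gabriel-Roiter measure of a module. -/
noncomputable def muMod (M : Type v) [AddCommGroup M] [Module Λ M] : ℝ :=
  mu Λ (⊤ : Submodule Λ M)

/-- `X` is a Gabriel-Roiter submodule of the (indecomposable, non-simple) ambient
module `Y`: `X` is an indecomposable proper submodule with `μ(Y) = μ(X) + 2^(-|Y|)`. -/
def IsGRSub {Y : Type v} [AddCommGroup Y] [Module Λ Y] (X : Submodule Λ Y) : Prop :=
  IndecMod Λ Y ∧ IndecSub Λ X ∧ X ≠ ⊤ ∧
    mu Λ (⊤ : Submodule Λ Y) = mu Λ X + (2 : ℝ) ^ (-(subLen Λ (⊤ : Submodule Λ Y) : ℤ))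

/-- A map `u : X → Y` is a Gabriel-Roiter inclusion iff it is injective and its
image is a Gabriel-Roiter submodule of `Y`. -/
def IsGRInclusion {X Y : Type v} [AddCommGroup X] [Module Λ X] [AddCommGroup Y] [Module Λ Y]
    (u : X →ₗ[Λ] Y) : Prop :=
  Function.Injective u ∧ IsGRSub Λ (LinearMap.range u)

/-- A linear map is a split monomorphism. -/
def IsSplitMonoHom {A B : Type v} [AddCommGroup A] [Module Λ A] [AddCommGroup B] [Module Λ B]
    (f : A →ₗ[Λ] B) : Prop :=
  ∃ g : B →ₗ[Λ] A, g.comp f = LinearMap.id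

/-- A linear map is a split epimorphism. -/
def IsSplitEpiHom {A B : Type v} [AddCommGroup A] [Module Λ A] [AddCommGroup B] [Module Λ B]
    (f : A →ₗ[Λ] B) : Prop :=
  ∃ g : B →ₗ[Λ] A, f.comp g = LinearMap.id

/-- A morphism `f` in the category of finite length `Λ`-modules is irreducible if it is
neither a split monomorphism nor a split epimorphism and, whenever `f = g ∘ h` with the
intermediate module of finite length, either `h` is a split monomorphism or `g` is a
split epimorphism. -/
def IsIrreducibleHom {A B : Type v} [AddCommGroup A] [Module Λ A] [AddCommGroup B] [Module Λ B]
    (f : A →ₗ[Λ] B) : Prop :=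
  ¬ IsSplitMonoHom Λ f ∧ ¬ IsSplitEpiHom Λ f ∧
    ∀ (Z : Type v) [AddCommGroup Z] [Module Λ Z], IsFiniteLength Λ Z →
      ∀ (h : A →ₗ[Λ] Z) (g : Z →ₗ[Λ] B), f = g.comp h →
        IsSplitMonoHom Λ h ∨ IsSplitEpiHom Λ g

/-- An indecomposable submodule `U` of the ambient module is piling provided
`μ(V) ≤ μ(U)` for every indecomposable submodule `V` with `|V| ≤ |U|`. -/
def IsPilingSub {Y : Type v} [AddCommGroup Y] [Module Λ Y] (U : Submodule Λ Y) : Prop :=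
  IndecSub Λ U ∧ ∀ V : Submodule Λ Y, IndecSub Λ V →
    Order.height V ≤ Order.height U → mu Λ V ≤ mu Λ U

/-- A Gabriel-Roiter filtration `c 0 ⊂ c 1 ⊂ ⋯ ⊂ c t = N` of an (indecomposable)
submodule `N`: a chain of indecomposable submodules starting at a simple module such
that each inclusion `c i ⊂ c (i+1)` is a Gabriel-Roiter inclusion,
i.e. `μ(c (i+1)) = μ(c i) + 2^(-|c (i+1)|)`. -/
def IsGRFiltration {Y : Type v} [AddCommGroup Y] [Module Λ Y] {t : ℕ}
    (c : Fin (t + 1) → Submodule Λ Y) (N : Submodule Λ Y) : Prop :=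
  c (Fin.last t) = N ∧
  IsSimpleModule Λ (c 0) ∧
  (∀ i : Fin (t + 1), IndecSub Λ (c i)) ∧
  ∀ i : Fin t, c i.castSucc < c i.succ ∧
    mu Λ (c i.succ) = mu Λ (c i.castSucc) + (2 : ℝ) ^ (-(subLen Λ (c i.succ) : ℤ))

/-- A brick: a nonzero module all of whose nonzero endomorphisms are invertible
(i.e. the endomorphism ring is a division ring). -/
def IsBrick (M : Type v) [AddCommGroup M] [Module Λ M] : Prop :=
  (∃ x : M, x ≠ 0) ∧ ∀ f : M →ₗ[Λ] M, f ≠ 0 → Function.Bijective f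

/-- An `M`-filtration `0 = c 0 ⊂ c 1 ⊂ ⋯ ⊂ c m = Y` of the module `Y`
(so `c j` is the module `M[j]`, with `M[0] = 0`, and the `M`-length of `Y` is `m`):
all consecutive factors `c (i+1) / c i` are isomorphic to `M`. -/
structure IsMFiltration (M : Type v) [AddCommGroup M] [Module Λ M]
    {Y : Type v} [AddCommGroup Y] [Module Λ Y] {m : ℕ}
    (c : Fin (m + 1) → Submodule Λ Y) : Prop where
  bot : c 0 = ⊥
  top : c (Fin.last m) = ⊤
  lt : ∀ i : Fin m, c i.castSucc < c i.succ
  quot : ∀ i : Fin m,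
    Nonempty ((↥(c i.succ) ⧸ comap (c i.succ).subtype (c i.castSucc)) ≃ₗ[Λ] M)

/-- A homogeneous `M`-filtration: an `M`-filtration in which moreover all the
`M[i] = c i` with `i ≥ 1` are indecomposable and all the inclusions
`M[i-1] ⊂ M[i]` for `2 ≤ i ≤ m` are irreducible monomorphisms. -/
structure IsHomogMFiltration (M : Type v) [AddCommGroup M] [Module Λ M]
    {Y : Type v} [AddCommGroup Y] [Module Λ Y] {m : ℕ}
    (c : Fin (m + 1) → Submodule Λ Y) extends IsMFiltration Λ M c : Prop where
  indec : ∀ i : Fin (m + 1), i ≠ 0 → IndecSub Λ (c i)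
  irr : ∀ i : Fin m, (i : ℕ) ≠ 0 →
    IsIrreducibleHom Λ (Submodule.inclusion (toIsMFiltration.lt i).le)

end GRDefs

section Measure

variable {Λ : Type u} [Ring Λ] {Y Z : Type v} [AddCommGroup Y] [Module Λ Y]
  [AddCommGroup Z] [Module Λ Z]

theorem height_map_of_injective (g : Y →ₗ[Λ] Z) (hg : Function.Injective g)
    (N : Submodule Λ Y) : Order.height (N.map g) = Order.height N := by
  rw [← Module.length_submodule, ← Module.length_submodule,
    (Submodule.equivMapOfInjective g hg N).length_eq]

theorem subLen_map_of_injective (g : Y →ₗ[Λ] Z) (hg : Function.Injective g)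
    (N : Submodule Λ Y) : subLen Λ (N.map g) = subLen Λ N := by
  rw [subLen, subLen, height_map_of_injective g hg]

theorem indecSub_map_iff (g : Y →ₗ[Λ] Z) (hg : Function.Injective g) (N : Submodule Λ Y) :
    IndecSub Λ (N.map g) ↔ IndecSub Λ N := by
  have hinj := Submodule.map_injective_of_injective hg
  have hbot (A : Submodule Λ Y) : A.map g = ⊥ ↔ A = ⊥ := by
    rw [← Submodule.map_bot g, hinj.eq_iff]
  refine and_congr (not_congr (hbot N)) ⟨fun h A B hA hB hs hi => ?_, fun h A B hA hB hs hi => ?_⟩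
  · simpa only [hbot] using h (A.map g) (B.map g) (Submodule.map_mono hA) (Submodule.map_mono hB)
      (by rw [← Submodule.map_sup, hs]) (by rw [← Submodule.map_inf _ hg, hi, Submodule.map_bot])
  · obtain ⟨A, rfl⟩ : ∃ A' : Submodule Λ Y, A'.map g = A :=
      ⟨A.comap g, Submodule.map_comap_eq_self (hA.trans LinearMap.map_le_range)⟩
    obtain ⟨B, rfl⟩ : ∃ B' : Submodule Λ Y, B'.map g = B :=
      ⟨B.comap g, Submodule.map_comap_eq_self (hB.trans LinearMap.map_le_range)⟩
    rw [Submodule.map_le_map_iff_of_injective hg] at hA hB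
    rw [← Submodule.map_sup, hinj.eq_iff] at hs
    rw [← Submodule.map_inf _ hg, hbot] at hi
    simpa only [hbot] using h A B hA hB hs hi

theorem muAux_map_of_injective (g : Y →ₗ[Λ] Z) (hg : Function.Injective g) (n : ℕ)
    (N : Submodule Λ Y) : muAux Λ n (N.map g) = muAux Λ n N := by
  induction n generalizing N with
  | zero => rfl
  | succ n ih =>
    have himage : muAux Λ n '' {N' : Submodule Λ Z | N' < N.map g} =
        muAux Λ n '' {N' : Submodule Λ Y | N' < N} := by
      ext r
      constructor
      · rintro ⟨A, hA, rfl⟩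
        obtain ⟨A, rfl⟩ : ∃ A' : Submodule Λ Y, A'.map g = A :=
          ⟨A.comap g, Submodule.map_comap_eq_self
            ((show A < N.map g from hA).le.trans LinearMap.map_le_range)⟩
        exact ⟨A, lt_of_le_not_ge ((Submodule.map_le_map_iff_of_injective hg _ _).1 hA.le)
          fun h => hA.not_ge (Submodule.map_mono h), (ih A).symm⟩
      · rintro ⟨A, hA, rfl⟩
        exact ⟨A.map g, Submodule.map_strictMono_of_injective hg hA, ih A⟩
    rw [muAux, muAux, himage, subLen_map_of_injective g hg, propext (indecSub_map_iff g hg N)]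

theorem mu_map_of_injective (g : Y →ₗ[Λ] Z) (hg : Function.Injective g)
    (N : Submodule Λ Y) : mu Λ (N.map g) = mu Λ N := by
  rw [mu, mu, subLen_map_of_injective g hg, muAux_map_of_injective g hg]

theorem muMod_coe (N : Submodule Λ Y) : muMod Λ N = mu Λ N := by
  rw [muMod, ← mu_map_of_injective N.subtype N.injective_subtype, Submodule.map_subtype_top]

theorem indecMod_coe_iff (N : Submodule Λ Y) : IndecMod Λ N ↔ IndecSub Λ N := by
  rw [IndecMod, ← indecSub_map_iff N.subtype N.injective_subtype, Submodule.map_subtype_top]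

theorem indecSub_range (f : Y →ₗ[Λ] Z) (hf : Function.Injective f) (hY : IndecMod Λ Y) :
    IndecSub Λ (LinearMap.range f) := by
  rwa [← Submodule.map_top, indecSub_map_iff f hf]

theorem mu_range (f : Y →ₗ[Λ] Z) (hf : Function.Injective f) :
    mu Λ (LinearMap.range f) = muMod Λ Y := by
  rw [← Submodule.map_top, mu_map_of_injective f hf, muMod]

theorem exists_decomposition {N : Submodule Λ Y} (hN : N ≠ ⊥) (h : ¬ IndecSub Λ N) :
    ∃ A B : Submodule Λ Y, A < N ∧ B < N ∧ A ⊔ B = N ∧ A ⊓ B = ⊥ ∧ A ≠ ⊥ ∧ B ≠ ⊥ := by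
  simp only [IndecSub, not_and, not_forall, not_or] at h
  obtain ⟨A, B, hA, hB, hs, hi, hA0, hB0⟩ := h hN
  refine ⟨A, B, lt_of_le_of_ne hA ?_, lt_of_le_of_ne hB ?_, hs, hi, hA0, hB0⟩
  · rintro rfl
    exact hB0 (by rwa [inf_eq_right.2 hB] at hi)
  · rintro rfl
    exact hA0 (by rwa [inf_eq_left.2 hA] at hi)

variable [IsNoetherian Λ Y] [IsArtinian Λ Y]

theorem coe_subLen (N : Submodule Λ Y) : (subLen Λ N : ℕ∞) = Order.height N :=
  ENat.natCast_toNat N.height_lt_top.ne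

theorem subLen_mono {N' N : Submodule Λ Y} (h : N' ≤ N) : subLen Λ N' ≤ subLen Λ N := by
  rw [← Nat.cast_le (α := ℕ∞), coe_subLen, coe_subLen]
  exact Order.height_mono h

theorem subLen_lt {N' N : Submodule Λ Y} (h : N' < N) : subLen Λ N' < subLen Λ N := by
  rw [← Nat.cast_lt (α := ℕ∞), coe_subLen, coe_subLen]
  exact Submodule.height_strictMono h

theorem finite_range_muAux (n : ℕ) :
    (Set.range (muAux Λ n : Submodule Λ Y → ℝ)).Finite := by
  induction n with
  | zero => exact (Set.finite_singleton (0 : ℝ)).subset (by rintro _ ⟨N, rfl⟩; simp [muAux])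
  | succ n ih =>
    have hlen : ((fun l : ℕ => (2 : ℝ) ^ (-(l : ℤ))) ''
        Set.Iic (subLen Λ (⊤ : Submodule Λ Y)) ∪ {0}).Finite :=
      ((Set.finite_Iic _).image _).union (Set.finite_singleton _)
    refine (hlen.image2 (· + ·) (ih.finite_subsets.image sSup)).subset ?_
    rintro _ ⟨N, rfl⟩
    refine ⟨_, ?_, _, ⟨_, Set.image_subset_range _ {N' | N' < N}, rfl⟩, rfl⟩
    split_ifs
    · exact Or.inl ⟨_, subLen_mono le_top, rfl⟩
    · exact Or.inr rfl

theorem muAux_eq_mu (n : ℕ) (N : Submodule Λ Y) (h : subLen Λ N ≤ n) :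
    muAux Λ n N = mu Λ N := by
  suffices ∀ m n (N : Submodule Λ Y), subLen Λ N ≤ m → subLen Λ N ≤ n →
      muAux Λ m N = muAux Λ n N from this _ _ N h le_rfl
  intro m
  have hbot (N : Submodule Λ Y) (h : subLen Λ N ≤ 0) : N = ⊥ := by
    by_contra h0
    exact absurd (subLen_lt (bot_lt_iff_ne_bot.2 h0)) (by omega)
  have haux (k : ℕ) : muAux Λ k (⊥ : Submodule Λ Y) = 0 := by
    cases k <;> simp [muAux, IndecSub]
  induction m with
  | zero =>
    intro n N hm _
    rw [hbot N hm, haux, haux]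
  | succ m ih =>
    rintro (_ | n) N hm hn
    · rw [hbot N hn, haux, haux]
    · rw [muAux, muAux]
      congr 2
      refine Set.image_congr fun N' hN' => ?_
      have := subLen_lt (show N' < N from hN')
      exact ih n N' (by omega) (by omega)

open Classical in
theorem mu_eq (N : Submodule Λ Y) : mu Λ N =
    (if IndecSub Λ N then (2 : ℝ) ^ (-(subLen Λ N : ℤ)) else 0)
      + sSup (mu Λ '' {N' : Submodule Λ Y | N' < N}) := by
  rw [← muAux_eq_mu (subLen Λ N + 1) N (Nat.le_succ _), muAux]
  congr 2
  exact Set.image_congr fun N' hN' => muAux_eq_mu _ _ (subLen_lt hN').le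

theorem finite_mu_image (S : Set (Submodule Λ Y)) : (mu Λ '' S).Finite := by
  refine (finite_range_muAux (Λ := Λ) (Y := Y) (subLen Λ (⊤ : Submodule Λ Y))).subset ?_
  rintro _ ⟨N, -, rfl⟩
  exact ⟨N, muAux_eq_mu _ _ (subLen_mono le_top)⟩

theorem mu_le_sSup {N' N : Submodule Λ Y} (h : N' < N) :
    mu Λ N' ≤ sSup (mu Λ '' {N' : Submodule Λ Y | N' < N}) :=
  le_csSup (finite_mu_image _).bddAbove ⟨N', h, rfl⟩

theorem mu_add_le_of_lt {N' N : Submodule Λ Y} (hN : IndecSub Λ N) (h : N' < N) :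
    mu Λ N' + (2 : ℝ) ^ (-(subLen Λ N : ℤ)) ≤ mu Λ N := by
  rw [mu_eq N, if_pos hN, add_comm]
  gcongr
  exact mu_le_sSup h

theorem mu_mono {N' N : Submodule Λ Y} (h : N' ≤ N) : mu Λ N' ≤ mu Λ N := by
  rcases h.eq_or_lt with rfl | h
  · rfl
  · rw [mu_eq N]
    refine le_add_of_nonneg_of_le ?_ (mu_le_sSup h)
    split_ifs <;> positivity

theorem exists_lt_mu_eq_sSup {N A : Submodule Λ Y} (hA : A < N) (hA0 : A ≠ ⊥) :
    ∃ N' < N, N' ≠ ⊥ ∧ mu Λ N' = sSup (mu Λ '' {N' : Submodule Λ Y | N' < N}) := by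
  obtain ⟨N', hN', h⟩ := Set.Nonempty.csSup_mem (⟨_, A, hA, rfl⟩ :
    (mu Λ '' {N' : Submodule Λ Y | N' < N}).Nonempty) (finite_mu_image _)
  by_cases h0 : N' = ⊥
  · subst h0
    exact ⟨A, hA, hA0, le_antisymm (mu_le_sSup hA) (h ▸ mu_mono bot_le)⟩
  · exact ⟨N', hN', h0, h⟩

theorem exists_indecSub_mu_eq (N : Submodule Λ Y) (hN : N ≠ ⊥) :
    ∃ N' ≤ N, IndecSub Λ N' ∧ mu Λ N' = mu Λ N := by
  induction N using WellFoundedLT.induction with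
  | ind N ih =>
    by_cases hind : IndecSub Λ N
    · exact ⟨N, le_rfl, hind, rfl⟩
    · obtain ⟨A, -, hA, -, -, -, hA0, -⟩ := exists_decomposition hN hind
      obtain ⟨N', hlt, h0, heq⟩ := exists_lt_mu_eq_sSup hA hA0
      obtain ⟨W, hW, hWind, hWmu⟩ := ih N' hlt h0
      refine ⟨W, hW.trans hlt.le, hWind, ?_⟩
      rw [mu_eq N, if_neg hind, zero_add, hWmu, heq]

/-- An indecomposable module with a nonzero proper submodule has a Gabriel-Roiter submodule. -/
theorem exists_isGRSub (hY : IndecMod Λ Y) {A : Submodule Λ Y} (hA : A < ⊤) (hA0 : A ≠ ⊥) :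
    ∃ X : Submodule Λ Y, IsGRSub Λ X := by
  obtain ⟨N', hlt, h0, heq⟩ := exists_lt_mu_eq_sSup hA hA0
  obtain ⟨W, hW, hWind, hWmu⟩ := exists_indecSub_mu_eq N' h0
  refine ⟨W, hY, hWind, (hW.trans_lt hlt).ne, ?_⟩
  rw [mu_eq ⊤, if_pos (show IndecSub Λ (⊤ : Submodule Λ Y) from hY), hWmu, heq, add_comm]

end Measure

section Embedding

variable {Λ : Type u} [Ring Λ]

theorem height_range_lt_of_not_injective {X Y : Type v} [AddCommGroup X] [Module Λ X]
    [IsNoetherian Λ X] [IsArtinian Λ X] [AddCommGroup Y] [Module Λ Y] (f : X →ₗ[Λ] Y)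
    (hf : ¬ Function.Injective f) :
    Order.height (LinearMap.range f) < Order.height (⊤ : Submodule Λ X) := by
  rw [← Module.length_submodule, ← f.quotKerEquivRange.length_eq, ← Module.length_eq_height]
  exact Submodule.length_quotient_lt _ fun h => hf (LinearMap.ker_eq_bot.1 h)

theorem exists_indecSub_range_of_apply_ne_zero {X Y : Type v} [AddCommGroup X] [Module Λ X]
    [AddCommGroup Y] [Module Λ Y] [IsArtinian Λ Y] (g : X →ₗ[Λ] Y) {x : X} (hx : g x ≠ 0) :
    ∃ f : X →ₗ[Λ] Y, IndecSub Λ (LinearMap.range f) ∧ LinearMap.range f ≤ LinearMap.range g ∧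
      LinearMap.ker g ≤ LinearMap.ker f ∧ f x ≠ 0 := by
  induction hN : LinearMap.range g using WellFoundedLT.induction generalizing g with
  | ind N ih =>
    subst hN
    by_cases hind : IndecSub Λ (LinearMap.range g)
    · exact ⟨g, hind, le_rfl, le_rfl, hx⟩
    have hN0 : LinearMap.range g ≠ ⊥ := fun h => hx <| by
      simpa [h] using LinearMap.mem_range_self g x
    obtain ⟨A, B, hA, hB, hs, hi, -, -⟩ := exists_decomposition hN0 hind
    have hc : IsCompl (A.submoduleOf (LinearMap.range g)) (B.submoduleOf (LinearMap.range g)) := by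
      constructor
      · rw [disjoint_iff, Submodule.submoduleOf, Submodule.submoduleOf, ← Submodule.comap_inf, hi,
          Submodule.comap_bot, Submodule.ker_subtype]
      · rw [codisjoint_iff, ← Submodule.submoduleOf_sup_of_le hA.le hB.le, hs,
          Submodule.submoduleOf_self]
    have key (A B : Submodule Λ Y) (hA : A < LinearMap.range g) (hc : IsCompl
        (A.submoduleOf (LinearMap.range g)) (B.submoduleOf (LinearMap.range g)))
        (h : (Submodule.projection _ _ hc (g.rangeRestrict x) : Y) ≠ 0) :
        ∃ f : X →ₗ[Λ] Y, IndecSub Λ (LinearMap.range f) ∧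
          LinearMap.range f ≤ LinearMap.range g ∧
          LinearMap.ker g ≤ LinearMap.ker f ∧ f x ≠ 0 := by
      let p : X →ₗ[Λ] Y := (LinearMap.range g).subtype ∘ₗ Submodule.projection _ _ hc ∘ₗ
        g.rangeRestrict
      have hp : LinearMap.range p ≤ A := by
        rintro _ ⟨y, rfl⟩
        exact Submodule.projection_apply_mem hc (g.rangeRestrict y)
      have hk : LinearMap.ker g ≤ LinearMap.ker p := by
        intro y hy
        have : g.rangeRestrict y = 0 := Subtype.ext hy
        simp [p, this]
      obtain ⟨f, hf, hfr, hfk, hfx⟩ := ih _ (hp.trans_lt hA) p h rfl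
      exact ⟨f, hf, hfr.trans (hp.trans hA.le), hk.trans hfk, hfx⟩
    by_cases h : (Submodule.projection _ _ hc (g.rangeRestrict x) : Y) = 0
    · refine key B A hB hc.symm fun h' => hx ?_
      have := congrArg (Subtype.val)
        (Submodule.projection_add_projection_eq_self hc (g.rangeRestrict x))
      rw [Submodule.coe_add, h, h', add_zero] at this
      exact this.symm
    · exact key A B hA hc h

/-- A quantitative form of Gabriel's main property: if an indecomposable module `X` is embedded
into a product of copies of `Y` without any component being injective, then the image of some
component contains an indecomposable submodule of measure at least `μ(X) + 2^{-|X|}`. -/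
theorem exists_injective_or_exists_mu_ge {Y : Type v} [AddCommGroup Y] [Module Λ Y]
    [IsNoetherian Λ Y] [IsArtinian Λ Y] (n : ℕ) (X : Type v) [AddCommGroup X] [Module Λ X]
    [IsNoetherian Λ X] [IsArtinian Λ X] (hX : IndecMod Λ X)
    (hn : subLen Λ (⊤ : Submodule Λ X) ≤ n)
    (S : Set (X →ₗ[Λ] Y)) (hS : ∀ x ≠ 0, ∃ f ∈ S, f x ≠ 0) :
    (∃ f ∈ S, Function.Injective f) ∨
      ∃ f ∈ S, ∃ W ≤ LinearMap.range f, IndecSub Λ W ∧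
        muMod Λ X + (2 : ℝ) ^ (-(subLen Λ (⊤ : Submodule Λ X) : ℤ)) ≤ mu Λ W := by
  induction n generalizing X with
  | zero =>
    have := subLen_lt (bot_lt_iff_ne_bot.2 hX.1)
    omega
  | succ n ih =>
    refine or_iff_not_imp_left.2 fun hinj => ?_
    push Not at hinj
    obtain ⟨x, -, hx⟩ := Submodule.exists_mem_ne_zero_of_ne_bot hX.1
    obtain ⟨f₀, hf₀, hf₀x⟩ := hS x hx
    have hker : LinearMap.ker f₀ ≠ ⊥ := fun h => hinj f₀ hf₀ (LinearMap.ker_eq_bot.1 h)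
    have hker' : LinearMap.ker f₀ < ⊤ := lt_top_iff_ne_top.2 fun h => hf₀x <| by
      have : x ∈ LinearMap.ker f₀ := h ▸ Submodule.mem_top
      exact this
    obtain ⟨X', -, hX', hX't, hmu⟩ := exists_isGRSub hX hker' hker
    have hlt := subLen_lt (lt_top_iff_ne_top.2 hX't)
    have hpow (l : ℕ) (hl : l < subLen Λ (⊤ : Submodule Λ X)) :
        muMod Λ X + (2 : ℝ) ^ (-(subLen Λ (⊤ : Submodule Λ X) : ℤ)) ≤
          mu Λ X' + (2 : ℝ) ^ (-(l : ℤ)) := by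
      rw [muMod, hmu, add_assoc, ← two_mul, ← zpow_one_add₀ two_ne_zero]
      gcongr
      · norm_num
      · omega
    have hlen : subLen Λ (⊤ : Submodule Λ X') = subLen Λ X' := by
      rw [← subLen_map_of_injective X'.subtype X'.injective_subtype, Submodule.map_subtype_top]
    let T : Set (X →ₗ[Λ] Y) := {f | IndecSub Λ (LinearMap.range f) ∧
      ¬ Function.Injective f ∧ ∃ g ∈ S, LinearMap.range f ≤ LinearMap.range g}
    have hT : ∀ y ≠ 0, ∃ f ∈ (· ∘ₗ X'.subtype) '' T, f y ≠ 0 := by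
      intro y hy
      obtain ⟨g, hg, hgy⟩ := hS y fun h => hy (Subtype.ext h)
      obtain ⟨f, hf, hfg, hk, hfy⟩ := exists_indecSub_range_of_apply_ne_zero g hgy
      refine ⟨_, ⟨f, ⟨hf, fun h => hinj g hg ?_, g, hg, hfg⟩, rfl⟩, hfy⟩
      rw [← LinearMap.ker_eq_bot] at h ⊢
      exact le_bot_iff.1 (h ▸ hk)
    rcases ih X' ((indecMod_coe_iff X').2 hX') (by omega) _ hT with
      ⟨_, ⟨f, ⟨hf, hfni, g, hg, hfg⟩, rfl⟩, hfinj⟩ |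
      ⟨_, ⟨f, ⟨hf, -, g, hg, hfg⟩, rfl⟩, W, hW, hWi, hWmu⟩
    · refine ⟨g, hg, _, hfg, hf, ?_⟩
      have hrange : LinearMap.range (f ∘ₗ X'.subtype) = X'.map f := by
        rw [LinearMap.range_comp, Submodule.range_subtype]
      have hdisj : X' ⊓ LinearMap.ker f = ⊥ := by
        refine (Submodule.eq_bot_iff _).2 fun y hy => ?_
        have h0 : (f ∘ₗ X'.subtype) ⟨y, hy.1⟩ = (f ∘ₗ X'.subtype) 0 := by
          simpa using hy.2
        exact congrArg Subtype.val (hfinj h0)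
      have hmap : X'.map f < LinearMap.range f := by
        refine lt_of_le_of_ne LinearMap.map_le_range fun h => ?_
        have hsup : X' ⊔ LinearMap.ker f = ⊤ := by
          rw [← Submodule.comap_map_eq, h, LinearMap.range_eq_map, Submodule.comap_map_eq,
            top_sup_eq]
        rcases hX.2 X' (LinearMap.ker f) le_top le_top hsup hdisj with h | h
        · exact hX'.1 h
        · exact hfni (LinearMap.ker_eq_bot.1 h)
      have hl : subLen Λ (LinearMap.range f) < subLen Λ (⊤ : Submodule Λ X) := by
        rw [← Nat.cast_lt (α := ℕ∞), coe_subLen, coe_subLen]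
        exact height_range_lt_of_not_injective f hfni
      refine (hpow _ hl).trans ?_
      rw [← muMod_coe X', ← mu_range _ hfinj, hrange]
      exact mu_add_le_of_lt hf hmap
    · refine ⟨g, hg, W, hW.trans (le_trans ?_ hfg), hWi, (hpow _ hlt).trans ?_⟩
      · exact LinearMap.range_comp_le_range _ _
      · rwa [hlen, muMod_coe] at hWmu

end Embedding

section Piling

variable {Λ : Type u} [Ring Λ] {Y : Type v} [AddCommGroup Y] [Module Λ Y]

theorem height_top_coe (U : Submodule Λ Y) :
    Order.height (⊤ : Submodule Λ U) = Order.height U := by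
  rw [← Module.length_eq_height, Module.length_submodule]

theorem IsPilingSub.range {U : Submodule Λ Y} (hU : IsPilingSub Λ U) (f : U →ₗ[Λ] Y)
    (hf : Function.Injective f) : IsPilingSub Λ (LinearMap.range f) := by
  refine ⟨indecSub_range f hf ((indecMod_coe_iff U).2 hU.1), fun V hV hVf => ?_⟩
  rw [mu_range f hf, muMod_coe]
  refine hU.2 V hV ?_
  rwa [← Module.length_submodule, ← Module.length_submodule,
    ← (LinearEquiv.ofInjective f hf).length_eq, Module.length_submodule,
    Module.length_submodule] at hVf

variable [IsNoetherian Λ Y] [IsArtinian Λ Y]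

theorem IsPilingSub.exists_injective {U : Submodule Λ Y} (hU : IsPilingSub Λ U)
    (S : Set (U →ₗ[Λ] Y)) (hS : ∀ x ≠ 0, ∃ f ∈ S, f x ≠ 0) :
    ∃ f ∈ S, Function.Injective f := by
  rcases exists_injective_or_exists_mu_ge _ U ((indecMod_coe_iff U).2 hU.1) le_rfl S hS with
    h | ⟨f, -, W, hWf, hW, hmu⟩
  · exact h
  · have hh : Order.height W ≤ Order.height U := by
      refine (Order.height_mono hWf).trans ?_
      rw [← Module.length_submodule, ← Module.length_submodule]
      exact Module.length_le_of_surjective f.rangeRestrict f.surjective_rangeRestrict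
    have hle := hU.2 W hW hh
    rw [muMod_coe] at hmu
    have : (0 : ℝ) < (2 : ℝ) ^ (-(subLen Λ (⊤ : Submodule Λ U) : ℤ)) := by positivity
    linarith

theorem IsHomogMFiltration.exists_linearEquiv_of_isPilingSub {M : Type v} [AddCommGroup M]
    [Module Λ M] {m : ℕ} {c : Fin (m + 1) → Submodule Λ Y} (hc : IsHomogMFiltration Λ M c)
    (i : Fin (m + 1)) (U : Submodule Λ Y) (hUc : U ≤ c i) (hU : IsPilingSub Λ U)
    (hlen : Order.height U ≤ modLen Λ M) : ∃ N : Submodule Λ M, Nonempty (U ≃ₗ[Λ] N) := by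
  induction i using Fin.induction generalizing U with
  | zero => exact absurd (le_bot_iff.1 (hc.bot ▸ hUc)) hU.1.1
  | succ i ih =>
    obtain ⟨e⟩ := hc.quot i
    let p : U →ₗ[Λ] M := e.toLinearMap ∘ₗ Submodule.mkQ _ ∘ₗ Submodule.inclusion hUc
    have hp (u : U) : p u = 0 ↔ (u : Y) ∈ c i.castSucc := by
      simp [p]
    by_cases hinj : Function.Injective p
    · exact ⟨_, ⟨LinearEquiv.ofInjective p hinj⟩⟩
    have hi : (i : ℕ) ≠ 0 := by
      intro h0
      refine hinj ((injective_iff_map_eq_zero p).2 fun u hu => ?_)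
      have : i.castSucc = 0 := Fin.ext h0
      rw [hp, this, hc.bot, Submodule.mem_bot] at hu
      exact Subtype.ext hu
    let D := c i.castSucc
    let P := D ⊔ U
    have hP : P ≤ c i.succ := sup_le (hc.lt i).le hUc
    have hPfl : IsFiniteLength Λ P :=
      isFiniteLength_iff_isNoetherian_isArtinian.2 ⟨inferInstance, inferInstance⟩
    rcases (hc.irr i hi).2.2 P hPfl (Submodule.inclusion le_sup_left) (Submodule.inclusion hP) rfl
      with ⟨r, hr⟩ | ⟨s, hs⟩
    · let f₁ : U →ₗ[Λ] Y := D.subtype ∘ₗ r ∘ₗ Submodule.inclusion le_sup_right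
      let f₂ : U →ₗ[Λ] Y := U.subtype - f₁
      have hf₁ : LinearMap.range f₁ ≤ c i.castSucc := by
        rintro _ ⟨u, rfl⟩
        exact (r _).2
      obtain ⟨f, rfl | rfl, hf⟩ := hU.exists_injective {f₁, f₂} (by
        intro u hu
        by_contra! h
        have h₁ := h f₁ (by simp)
        have h₂ := h f₂ (by simp)
        refine hu (Subtype.ext ?_)
        simpa [f₂, h₁] using h₂)
      · have e' := LinearEquiv.ofInjective f₁ hf
        obtain ⟨N, ⟨e''⟩⟩ := ih _ hf₁ (hU.range f₁ hf) (by
          rwa [← Module.length_submodule, ← e'.length_eq, Module.length_submodule])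
        exact ⟨N, ⟨e'.trans e''⟩⟩
      · refine absurd ((injective_iff_map_eq_zero p).2 fun u hu => ?_) hinj
        refine (injective_iff_map_eq_zero f₂).1 hf u ?_
        have h := congrArg Subtype.val (LinearMap.congr_fun hr ⟨u, (hp u).1 hu⟩)
        exact sub_eq_zero.2 h.symm
    · have hsurj : LinearMap.range p = ⊤ := by
        refine (Submodule.eq_top_iff').2 fun x => ?_
        obtain ⟨y, hy⟩ := Submodule.mkQ_surjective _ (e.symm x)
        have hyP : (y : Y) ∈ P := by
          have h := congrArg Subtype.val (LinearMap.congr_fun hs y)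
          exact (show ((s y : P) : Y) = y from h) ▸ (s y).2
        obtain ⟨d, hd, u, hu, hdu⟩ := Submodule.mem_sup.1 hyP
        refine ⟨⟨u, hu⟩, ?_⟩
        rw [← e.apply_symm_apply x, ← hy]
        refine congrArg e ((Submodule.Quotient.eq _).2 ?_)
        have : u - (y : Y) = -d := by rw [← hdu]; abel
        simpa [this] using hd
      have := height_range_lt_of_not_injective p hinj
      rw [hsurj, height_top_coe] at this
      exact absurd hlen this.not_ge

end Piling

/-- Let `M` be indecomposable and `Y` a module with a homogeneous
`M`-filtration. If `U` is a piling submodule of `Y` with `|U| ≤ |M|`, then `U` is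
isomorphic to a submodule of `M`. -/
theorem gabriel_roiter_stmt12
    (k : Type u) [CommRing k] [IsArtinianRing k]
    (Λ : Type u) [Ring Λ] [Algebra k Λ] [Module.Finite k Λ]
    (M : Type v) [AddCommGroup M] [Module Λ M] (hMfl : IsFiniteLength Λ M)
    (hMind : IndecMod Λ M)
    (Y : Type v) [AddCommGroup Y] [Module Λ Y] (hYfl : IsFiniteLength Λ Y)
    (m : ℕ) (c : Fin (m + 1) → Submodule Λ Y) (hc : IsHomogMFiltration Λ M c)
    (U : Submodule Λ Y) (hU : IsPilingSub Λ U)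
    (hlen : Order.height U ≤ modLen Λ M) :
    ∃ N : Submodule Λ M, Nonempty (↥U ≃ₗ[Λ] ↥N) := by
  obtain ⟨_, _⟩ := isFiniteLength_iff_isNoetherian_isArtinian.1 hYfl
  exact hc.exists_linearEquiv_of_isPilingSub (Fin.last m) U (hc.top ▸ le_top) hU hlen
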